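/- arXiv:2012.11266 — 4 statements merged into one kernel-verified Lean document; each statement's English description precedes it below -/
import Mathlib

section
/- Let μ be the fair-coin Bernoulli measure on Cantor space Σ^∞ and let T be the left shift. Let f ∈ L¹(μ) and suppose there are polynomials p and t and a sequence of functions f_n : Σ^∞ → ℝ such that for every n ≥ 1: (i) f_n is constant on every cylinder of length p(n) (i.e. f_n(x) depends only on the first p(n) bits of x); (ii) |f_n(x)| ≤ 2^{t(n)} for all x; and (iii) ‖f − f_n‖_{L¹(μ)} ≤ 2^{−n}. Then there is a polynomial q such that for every m ∈ ℕ and all n ≥ 2^{q(m)}, ‖A_n^f − ∫ f dμ‖_{L¹(μ)} ≤ 2^{−m}. -/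
open MeasureTheory

/-- Cantor space `Σ^∞`. -/
abbrev Cantor : Type := ℕ → Bool

/-- The cylinder `[σ]` of infinite sequences having the finite string `σ` as a prefix. -/
def cyl (σ : List Bool) : Set Cantor := {x | ∀ i : Fin σ.length, x i = σ.get i}

/-- The left shift `T : (T x)(n) = x(n+1)`. -/
def shift : Cantor → Cantor := fun x n => x (n + 1)

/-- The `n`-th Birkhoff average `A_n^f = (1/n) ∑_{i=0}^{n-1} f ∘ T^i`. -/
noncomputable def birkhoff (T : Cantor → Cantor) (f : Cantor → ℝ) (n : ℕ) (x : Cantor) : ℝ :=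
  (∑ i ∈ Finset.range n, f (T^[i] x)) / n

open ProbabilityTheory

theorem eq_infinitePi_uniform (μ : Measure Cantor)
    (hμ : ∀ σ : List Bool, μ (cyl σ) = (1 / 2) ^ σ.length) :
    μ = Measure.infinitePi fun _ : ℕ => (PMF.uniformOfFintype Bool).toMeasure := by
  set ν : ℕ → Measure Bool := fun _ => (PMF.uniformOfFintype Bool).toMeasure
  have h_proj : IsProjectiveLimit μ fun I : Finset ℕ => Measure.pi fun i : I => ν i := by
    rw [isProjectiveLimit_nat_iff (isProjectiveMeasureFamily_pi ν)]
    intro n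
    refine Measure.ext_of_singleton fun y => ?_
    rw [Measure.map_apply (by fun_prop) (measurableSet_singleton y), Measure.pi_singleton]
    have h_cyl : Preorder.frestrictLe (π := fun _ => Bool) n ⁻¹' {y} =
        cyl (List.ofFn fun i : Fin (n + 1) => y ⟨i, Finset.mem_Iic.2 (Nat.lt_succ_iff.1 i.2)⟩) := by
      ext x
      simp only [cyl, Set.mem_preimage, Set.mem_singleton_iff, Set.mem_ofPred_eq, funext_iff,
        Subtype.forall, Finset.mem_Iic, Preorder.frestrictLe_apply, List.get_ofFn]
      constructor
      · intro h i
        have hi : (i : ℕ) < n + 1 := by simpa using i.2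
        exact h i (by omega)
      · intro h i hi
        exact h ⟨i, by simp; omega⟩
    rw [h_cyl, hμ]
    simp [ν]
  exact h_proj.unique (Measure.isProjectiveLimit_infinitePi ν)

theorem shift_iterate_apply (i : ℕ) (x : Cantor) (k : ℕ) : shift^[i] x k = x (i + k) := by
  induction i generalizing x with
  | zero => simp
  | succ i ih => rw [Function.iterate_succ_apply, ih, shift]; congr 1; omega

theorem measurePreserving_shift (ν : Measure Bool) [IsProbabilityMeasure ν] :
    MeasurePreserving shift (Measure.infinitePi fun _ : ℕ => ν)
      (Measure.infinitePi fun _ : ℕ => ν) := by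
  refine ⟨measurable_pi_lambda _ fun n => measurable_pi_apply (n + 1), ?_⟩
  exact Measure.map_infinitePi_infinitePi_of_inj (P := fun _ : ℕ => ν) (Nat.succ_injective)

/-- A function of the first `P` bits factors through the restriction to any window of `P` bits
after shifting. -/
theorem exists_comp_shift_eq {g : Cantor → ℝ} {P : ℕ}
    (hg : ∀ x y : Cantor, (∀ i < P, x i = y i) → g x = g y) (i : ℕ) :
    ∃ φ : (Finset.Ico i (i + P) → Bool) → ℝ,
      ∀ x : Cantor, g (shift^[i] x) = φ fun k => x k := by
  refine ⟨fun y => g fun k => if h : k < P then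
    y ⟨i + k, Finset.mem_Ico.2 ⟨by omega, by omega⟩⟩ else false, fun x => hg _ _ fun k hk => ?_⟩
  simp [hk, shift_iterate_apply]

theorem measurable_of_finite_dependence {g : Cantor → ℝ} {P : ℕ}
    (hg : ∀ x y : Cantor, (∀ i < P, x i = y i) → g x = g y) : Measurable g := by
  obtain ⟨φ, hφ⟩ := exists_comp_shift_eq hg 0
  have : g = φ ∘ fun x k => x k := funext hφ
  rw [this]
  exact (measurable_of_finite φ).comp (by fun_prop)

theorem indepFun_comp_shift (ν : Measure Bool) [IsProbabilityMeasure ν] {g : Cantor → ℝ} {P : ℕ}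
    (hg : ∀ x y : Cantor, (∀ i < P, x i = y i) → g x = g y) {i j : ℕ} (hij : i + P ≤ j) :
    IndepFun (fun x => g (shift^[i] x)) (fun x => g (shift^[j] x))
      (Measure.infinitePi fun _ : ℕ => ν) := by
  obtain ⟨φ, hφ⟩ := exists_comp_shift_eq hg i
  obtain ⟨ψ, hψ⟩ := exists_comp_shift_eq hg j
  simp_rw [hφ, hψ]
  have h_bits : iIndepFun (fun (k : ℕ) (x : Cantor) => x k) (Measure.infinitePi fun _ : ℕ => ν) :=
    iIndepFun_infinitePi (X := fun _ b => b) fun _ => measurable_id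
  refine (h_bits.indepFun_finset (Finset.Ico i (i + P)) (Finset.Ico j (j + P)) ?_
    fun k => measurable_pi_apply k).comp (measurable_of_finite φ) (measurable_of_finite ψ)
  rw [Finset.disjoint_left]
  intro k
  simp only [Finset.mem_Ico]
  omega

/-- Second moment of a sum of bounded variables which are uncorrelated at distance at least `P`. -/
theorem integral_sum_sq_le {Ω : Type*} [MeasurableSpace Ω] {μ : Measure Ω} [IsProbabilityMeasure μ]
    {Y : ℕ → Ω → ℝ} {C : ℝ} {P : ℕ} (hY : ∀ i, Measurable (Y i)) (hC : ∀ i ω, |Y i ω| ≤ C)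
    (h_uncorr : ∀ i j, i + P ≤ j → ∫ ω, Y i ω * Y j ω ∂μ = 0) (n : ℕ) :
    ∫ ω, (∑ i ∈ Finset.range n, Y i ω) ^ 2 ∂μ ≤ n * (2 * P * C ^ 2) := by
  have h_bound : ∀ i j ω, ‖Y i ω * Y j ω‖ ≤ C ^ 2 := fun i j ω => by
    rw [norm_mul, sq]
    exact mul_le_mul (hC i ω) (hC j ω) (abs_nonneg _) ((abs_nonneg _).trans (hC i ω))
  have h_int : ∀ i j, Integrable (fun ω => Y i ω * Y j ω) μ := fun i j =>
    Integrable.of_bound ((hY i).mul (hY j)).aestronglyMeasurable (C ^ 2)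
      (Filter.Eventually.of_forall (h_bound i j))
  have h_row : ∀ i, ∑ j ∈ Finset.range n, ∫ ω, Y i ω * Y j ω ∂μ ≤ 2 * P * C ^ 2 := fun i => by
    have h_term : ∀ j, ∫ ω, Y i ω * Y j ω ∂μ ≤
        if j ∈ Finset.Ico (i + 1 - P) (i + P) then C ^ 2 else 0 := fun j => by
      split_ifs with h
      · have := norm_integral_le_of_norm_le_const (Filter.Eventually.of_forall (h_bound i j))
          (μ := μ)
        simp only [probReal_univ, mul_one] at this
        exact (le_abs_self _).trans this
      · rw [Finset.mem_Ico, not_and_or, not_le, not_lt] at h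
        rcases h with h | h
        · simp_rw [mul_comm (Y i _)]
          exact (h_uncorr j i (by omega)).le
        · exact (h_uncorr i j h).le
    calc ∑ j ∈ Finset.range n, ∫ ω, Y i ω * Y j ω ∂μ
        ≤ ∑ j ∈ Finset.range n, if j ∈ Finset.Ico (i + 1 - P) (i + P) then C ^ 2 else 0 :=
          Finset.sum_le_sum fun j _ => h_term j
      _ = ((Finset.range n ∩ Finset.Ico (i + 1 - P) (i + P)).card : ℝ) * C ^ 2 := by
          rw [Finset.sum_ite_mem, Finset.sum_const, nsmul_eq_mul]
      _ ≤ 2 * P * C ^ 2 := by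
          gcongr
          have h_card := Finset.card_le_card
            (Finset.inter_subset_right (s₁ := Finset.range n)
              (s₂ := Finset.Ico (i + 1 - P) (i + P)))
          rw [Nat.card_Ico] at h_card
          exact_mod_cast h_card.trans (by omega)
  calc ∫ ω, (∑ i ∈ Finset.range n, Y i ω) ^ 2 ∂μ
      = ∑ i ∈ Finset.range n, ∑ j ∈ Finset.range n, ∫ ω, Y i ω * Y j ω ∂μ := by
        simp_rw [sq, Finset.sum_mul_sum]
        rw [integral_finsetSum _ fun i _ => integrable_finsetSum _ fun j _ => h_int i j]
        exact Finset.sum_congr rfl fun i _ => integral_finsetSum _ fun j _ => h_int i j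
    _ ≤ ∑ i ∈ Finset.range n, 2 * P * C ^ 2 := Finset.sum_le_sum fun i _ => h_row i
    _ = n * (2 * P * C ^ 2) := by simp

theorem integral_abs_le_of_integral_sq_le {Ω : Type*} [MeasurableSpace Ω] {μ : Measure Ω}
    [IsProbabilityMeasure μ] {F : Ω → ℝ} {c : ℝ} (hc : 0 < c) (hF : MemLp F 2 μ)
    (h : ∫ ω, F ω ^ 2 ∂μ ≤ c ^ 2) : ∫ ω, |F ω| ∂μ ≤ c := by
  have h_point : ∀ ω, |F ω| ≤ F ω ^ 2 / (2 * c) + c / 2 := fun ω => by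
    rw [← sub_nonneg]
    have : F ω ^ 2 / (2 * c) + c / 2 - |F ω| = (|F ω| - c) ^ 2 / (2 * c) := by
      rw [← sq_abs (F ω)]
      field_simp
      ring
    rw [this]
    positivity
  have h_sq : Integrable (fun ω => F ω ^ 2 / (2 * c)) μ := hF.integrable_sq.div_const _
  calc ∫ ω, |F ω| ∂μ ≤ ∫ ω, (F ω ^ 2 / (2 * c) + c / 2) ∂μ :=
        integral_mono (hF.integrable one_le_two).abs (h_sq.add (integrable_const _)) h_point
    _ = (∫ ω, F ω ^ 2 ∂μ) / (2 * c) + c / 2 := by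
        rw [integral_add h_sq (integrable_const _), integral_div]
        simp
    _ ≤ c ^ 2 / (2 * c) + c / 2 := by gcongr
    _ = c := by field_simp; ring

/-- Birkhoff averages of a bounded function of finitely many bits converge in `L¹` at rate
`n ^ (-1/2)`. -/
theorem integral_abs_birkhoff_sub_le (ν : Measure Bool) [IsProbabilityMeasure ν] {g : Cantor → ℝ}
    {P n : ℕ} {B c : ℝ} (hg : ∀ x y : Cantor, (∀ i < P, x i = y i) → g x = g y)
    (hB : ∀ x, |g x| ≤ B) (hc : 0 < c) (hn : 0 < n) (h_rate : 8 * P * B ^ 2 ≤ n * c ^ 2) :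
    ∫ x, |birkhoff shift g n x - ∫ y, g y ∂Measure.infinitePi fun _ : ℕ => ν|
      ∂(Measure.infinitePi fun _ : ℕ => ν) ≤ c := by
  set μ := Measure.infinitePi fun _ : ℕ => ν
  have hg_meas := measurable_of_finite_dependence hg
  have h_pres := measurePreserving_shift ν
  have hg_int : Integrable g μ :=
    Integrable.of_bound hg_meas.aestronglyMeasurable B (Filter.Eventually.of_forall hB)
  set I := ∫ y, g y ∂μ with hI
  have hI_le : |I| ≤ B := by
    have := norm_integral_le_of_norm_le_const (Filter.Eventually.of_forall hB) (μ := μ) (f := g)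
    simpa using this
  set h : Cantor → ℝ := fun x => g x - I
  have hh_meas : Measurable h := hg_meas.sub_const _
  have hh_bound : ∀ x, |h x| ≤ 2 * B := fun x =>
    (abs_sub _ _).trans (by linarith [hB x])
  have hh_mean : ∫ x, h x ∂μ = 0 := by
    simp only [h]
    rw [integral_sub hg_int (integrable_const _)]
    simp [hI]
  have h_iter : ∀ i, Measurable fun x => h (shift^[i] x) := fun i =>
    hh_meas.comp (h_pres.iterate i).measurable
  have hh_mean_iter : ∀ i, ∫ x, h (shift^[i] x) ∂μ = 0 := fun i => by
    have := integral_map (h_pres.iterate i).aemeasurable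
      (f := h) hh_meas.aestronglyMeasurable
    rw [(h_pres.iterate i).map_eq] at this
    rw [← this, hh_mean]
  have h_sum : ∫ x, (∑ i ∈ Finset.range n, h (shift^[i] x)) ^ 2 ∂μ ≤
      n * (2 * P * (2 * B) ^ 2) := by
    refine integral_sum_sq_le h_iter (fun i x => hh_bound _) (fun i j hij => ?_) n
    have h_indep : IndepFun (fun x => h (shift^[i] x)) (fun x => h (shift^[j] x)) μ :=
      indepFun_comp_shift ν (fun x y hxy => by simp only [h, hg x y hxy]) hij
    rw [h_indep.integral_fun_mul_eq_mul_integral (h_iter i).aestronglyMeasurable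
      (h_iter j).aestronglyMeasurable, hh_mean_iter, zero_mul]
  have hn' : (0 : ℝ) < n := Nat.cast_pos.2 hn
  have h_eq : ∀ x, birkhoff shift g n x - I = (∑ i ∈ Finset.range n, h (shift^[i] x)) / n := by
    intro x
    simp only [birkhoff, h, Finset.sum_sub_distrib, Finset.sum_const, Finset.card_range,
      nsmul_eq_mul]
    field_simp
  simp_rw [h_eq]
  refine integral_abs_le_of_integral_sq_le hc ?_ ?_
  · refine MemLp.of_bound ((Finset.measurable_fun_sum _ fun i _ =>
      h_iter i).div_const _).aestronglyMeasurable (2 * B) (Filter.Eventually.of_forall fun x => ?_)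
    rw [Real.norm_eq_abs, abs_div, Nat.abs_cast, div_le_iff₀ hn']
    refine (Finset.abs_sum_le_sum_abs _ _).trans ?_
    refine (Finset.sum_le_sum fun i _ => hh_bound _).trans ?_
    simp [mul_comm]
  · simp_rw [div_pow]
    rw [integral_div, div_le_iff₀ (by positivity)]
    nlinarith

/-- The `L¹` error of a Birkhoff average is controlled by that of an approximating function. -/
theorem integral_abs_birkhoff_sub_integral_le {μ : Measure Cantor} [IsProbabilityMeasure μ]
    (h_pres : MeasurePreserving shift μ μ) {f g : Cantor → ℝ} (hf : Integrable f μ)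
    (hg : Integrable g μ) {n : ℕ} (hn : 0 < n) :
    Integrable (fun x => birkhoff shift f n x - ∫ y, f y ∂μ) μ ∧
    ∫ x, |birkhoff shift f n x - ∫ y, f y ∂μ| ∂μ ≤
      2 * ∫ x, |f x - g x| ∂μ + ∫ x, |birkhoff shift g n x - ∫ y, g y ∂μ| ∂μ := by
  have hn' : (0 : ℝ) < n := Nat.cast_pos.2 hn
  have h_birk : ∀ {u : Cantor → ℝ}, Integrable u μ → Integrable (birkhoff shift u n) μ := by
    intro u hu
    exact (integrable_finsetSum _ fun i _ =>
      (h_pres.iterate i).integrable_comp_of_integrable hu).div_const _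
  set d : Cantor → ℝ := fun x => |f x - g x|
  have hd : Integrable d μ := (hf.sub hg).abs
  have hd_iter : ∀ i, ∫ x, d (shift^[i] x) ∂μ = ∫ x, d x ∂μ := fun i => by
    have h_map := (h_pres.iterate i).map_eq
    have := integral_map (h_pres.iterate i).aemeasurable
      (f := d) (by rw [h_map]; exact hd.aestronglyMeasurable)
    rw [h_map] at this
    exact this.symm
  have hd_birk : ∫ x, birkhoff shift d n x ∂μ = ∫ x, d x ∂μ := by
    have hd_int : ∀ i, Integrable (fun x => d (shift^[i] x)) μ := fun i =>
      (h_pres.iterate i).integrable_comp_of_integrable hd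
    simp only [birkhoff]
    rw [integral_div, integral_finsetSum _ fun i _ => hd_int i]
    simp only [hd_iter, Finset.sum_const, Finset.card_range, nsmul_eq_mul]
    field_simp
  have h_const : |∫ y, g y ∂μ - ∫ y, f y ∂μ| ≤ ∫ x, d x ∂μ := by
    rw [abs_sub_comm, ← integral_sub hf hg]
    exact abs_integral_le_integral_abs
  have hf_int : Integrable (fun x => birkhoff shift f n x - ∫ y, f y ∂μ) μ :=
    (h_birk hf).sub (integrable_const _)
  have hg_abs : Integrable (fun x => |birkhoff shift g n x - ∫ y, g y ∂μ|) μ :=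
    ((h_birk hg).sub (integrable_const _)).abs
  have h_sum : Integrable
      (fun x => birkhoff shift d n x + |birkhoff shift g n x - ∫ y, g y ∂μ|) μ :=
    (h_birk hd).add hg_abs
  refine ⟨hf_int, ?_⟩
  have h_point : ∀ x, |birkhoff shift f n x - ∫ y, f y ∂μ| ≤
      birkhoff shift d n x + |birkhoff shift g n x - ∫ y, g y ∂μ| + ∫ x, d x ∂μ := by
    intro x
    have h_diff : |birkhoff shift f n x - birkhoff shift g n x| ≤ birkhoff shift d n x := by
      simp only [birkhoff]
      rw [← sub_div, ← Finset.sum_sub_distrib, abs_div, Nat.abs_cast]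
      gcongr
      exact Finset.abs_sum_le_sum_abs _ _
    have h_split : birkhoff shift f n x - ∫ y, f y ∂μ =
        (birkhoff shift f n x - birkhoff shift g n x) +
        (birkhoff shift g n x - ∫ y, g y ∂μ) + (∫ y, g y ∂μ - ∫ y, f y ∂μ) := by ring
    rw [h_split]
    exact (abs_add_three _ _ _).trans (by gcongr)
  calc ∫ x, |birkhoff shift f n x - ∫ y, f y ∂μ| ∂μ
      ≤ ∫ x, (birkhoff shift d n x + |birkhoff shift g n x - ∫ y, g y ∂μ| + ∫ x, d x ∂μ) ∂μ :=
        integral_mono hf_int.abs (h_sum.add (integrable_const _)) h_point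
    _ = 2 * ∫ x, d x ∂μ + ∫ x, |birkhoff shift g n x - ∫ y, g y ∂μ| ∂μ := by
        rw [integral_add h_sum (integrable_const _),
          integral_add (h_birk hd) hg_abs, hd_birk]
        simp only [integral_const, probReal_univ, one_smul]
        ring

theorem eLpNorm_one_eq_ofReal_integral_abs {Ω : Type*} [MeasurableSpace Ω] {μ : Measure Ω}
    {F : Ω → ℝ} (hF : Integrable F μ) : eLpNorm F 1 μ = ENNReal.ofReal (∫ ω, |F ω| ∂μ) := by
  rw [eLpNorm_one_eq_lintegral_enorm, ← ofReal_integral_norm_eq_lintegral_enorm hF]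
  rfl

theorem ofReal_one_div_two_pow (k : ℕ) : ENNReal.ofReal (1 / 2 ^ k) = 1 / 2 ^ k := by
  rw [ENNReal.ofReal_div_of_pos (by positivity), ENNReal.ofReal_pow (by norm_num)]
  simp

theorem l1_function_pspace_rapid
    (μ : Measure Cantor) [IsProbabilityMeasure μ]
    (hμ : ∀ σ : List Bool, μ (cyl σ) = (1 / 2) ^ σ.length)
    (f : Cantor → ℝ) (hf : Integrable f μ)
    (fseq : ℕ → Cantor → ℝ) (p t : Polynomial ℕ)
    (hcyl : ∀ n : ℕ, 1 ≤ n → ∀ x y : Cantor, (∀ i < p.eval n, x i = y i) → fseq n x = fseq n y)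
    (hbd : ∀ n : ℕ, 1 ≤ n → ∀ x : Cantor, |fseq n x| ≤ 2 ^ t.eval n)
    (happrox : ∀ n : ℕ, 1 ≤ n → eLpNorm (fun x => f x - fseq n x) 1 μ ≤ 1 / 2 ^ n) :
    ∃ q : Polynomial ℕ, ∀ m : ℕ, ∀ n : ℕ, 2 ^ q.eval m ≤ n →
      eLpNorm (fun x => birkhoff shift f n x - ∫ y, f y ∂μ) 1 μ ≤ 1 / 2 ^ m := by
  have h_prod := eq_infinitePi_uniform μ hμ
  have h_pres : MeasurePreserving shift μ μ := by
    rw [h_prod]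
    exact measurePreserving_shift _
  refine ⟨3 + p.comp (Polynomial.X + 2) + 2 * t.comp (Polynomial.X + 2) +
    2 * (Polynomial.X + 1), fun m n hmn => ?_⟩
  have hn : 0 < n := lt_of_lt_of_le (by positivity) hmn
  set N := m + 2 with hN
  have hN1 : 1 ≤ N := by omega
  have hg : Integrable (fseq N) μ :=
    Integrable.of_bound (measurable_of_finite_dependence (hcyl N hN1)).aestronglyMeasurable _
      (Filter.Eventually.of_forall (hbd N hN1))
  have h_dist : ∫ x, |f x - fseq N x| ∂μ ≤ 1 / 2 ^ N := by
    have h := happrox N hN1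
    have h_int : Integrable (fun x => f x - fseq N x) μ := hf.sub hg
    rwa [eLpNorm_one_eq_ofReal_integral_abs h_int, ← ofReal_one_div_two_pow,
      ENNReal.ofReal_le_ofReal_iff (by positivity)] at h
  have h_rate : 8 * ((p.eval N : ℕ) : ℝ) * (2 ^ t.eval N) ^ 2 ≤ n * (1 / 2 ^ (m + 1)) ^ 2 := by
    have h_eval : (2 : ℝ) ^ (3 + p.eval N + 2 * t.eval N + 2 * (m + 1)) ≤ n := by
      simp only [Polynomial.eval_add, Polynomial.eval_mul, Polynomial.eval_comp,
        Polynomial.eval_X, Polynomial.eval_ofNat, Polynomial.eval_one] at hmn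
      exact_mod_cast hmn
    have h_pow : ((p.eval N : ℕ) : ℝ) ≤ 2 ^ p.eval N := by exact_mod_cast Nat.lt_two_pow_self.le
    rw [one_div, inv_pow, ← div_eq_mul_inv, le_div_iff₀ (by positivity)]
    calc 8 * ((p.eval N : ℕ) : ℝ) * (2 ^ t.eval N) ^ 2 * (2 ^ (m + 1)) ^ 2
        ≤ 8 * 2 ^ p.eval N * (2 ^ t.eval N) ^ 2 * (2 ^ (m + 1)) ^ 2 := by gcongr
      _ = 2 ^ (3 + p.eval N + 2 * t.eval N + 2 * (m + 1)) := by ring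
      _ ≤ n := h_eval
  have h_simple : ∫ x, |birkhoff shift (fseq N) n x - ∫ y, fseq N y ∂μ| ∂μ ≤ 1 / 2 ^ (m + 1) := by
    rw [h_prod]
    exact integral_abs_birkhoff_sub_le _ (hcyl N hN1) (hbd N hN1) (by positivity) hn h_rate
  obtain ⟨h_int, h_le⟩ := integral_abs_birkhoff_sub_integral_le h_pres hf hg hn
  rw [eLpNorm_one_eq_ofReal_integral_abs h_int, ← ofReal_one_div_two_pow]
  refine ENNReal.ofReal_le_ofReal (h_le.trans ?_)
  calc _ ≤ 2 * (1 / 2 ^ N) + 1 / 2 ^ (m + 1) := by gcongr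
    _ = (1 : ℝ) / 2 ^ m := by rw [hN]; field_simp; ring
end

section
/- For every natural number m ≥ 1, ∑_{n=2(2m²+1)}^∞ n · 2^{−(log₂ n)²} ≤ 2^{−(log₂ m)²}, where log₂ denotes the real base-2 logarithm (equivalently, ∑_{n=2(2m²+1)}^∞ n · n^{−log₂ n} ≤ m^{−log₂ m}). -/
/-- A decreasing-tail bound: `x ^ (3 - log₂ x)` is decreasing for `x ≥ 4`. -/
theorem mul_two_rpow_neg_logb_sq_le {x T : ℝ} (hx : 0 < x) (hT : 2 ≤ T)
    (h : T ≤ Real.logb 2 x) :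
    x * (2 : ℝ) ^ (-(Real.logb 2 x) ^ 2) ≤ (2 : ℝ) ^ (3 * T - T ^ 2) / x ^ 2 := by
  have hxt : (2 : ℝ) ^ Real.logb 2 x = x := Real.rpow_logb (by norm_num) (by norm_num) hx
  rw [le_div_iff₀ (by positivity)]
  generalize Real.logb 2 x = t at *
  have h3 : x * (2 : ℝ) ^ (-t ^ 2) * x ^ 2 = (2 : ℝ) ^ (t + -t ^ 2 + t * (2 : ℕ)) := by
    rw [Real.rpow_add two_pos, Real.rpow_add two_pos, Real.rpow_mul_natCast two_pos.le, hxt]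
  rw [h3]
  apply Real.rpow_le_rpow_of_exponent_le one_le_two
  push_cast
  nlinarith

theorem sum_range_inv_add_sq_le {N : ℝ} (hN : 1 < N) (k : ℕ) :
    ∑ j ∈ Finset.range k, 1 / ((j : ℝ) + N) ^ 2 ≤ 1 / (N - 1) := by
  have hpos (j : ℕ) : 0 < (j : ℝ) + N - 1 := by
    have := j.cast_nonneg (α := ℝ)
    linarith
  calc ∑ j ∈ Finset.range k, 1 / ((j : ℝ) + N) ^ 2
      ≤ ∑ j ∈ Finset.range k, (1 / ((j : ℝ) + N - 1) - 1 / (((j + 1 : ℕ) : ℝ) + N - 1)) := by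
        refine Finset.sum_le_sum fun j _ => ?_
        have h1 := hpos j
        have h2 : 0 < (j : ℝ) + N := by linarith
        have h3 : ((j + 1 : ℕ) : ℝ) + N - 1 = j + N := by push_cast; ring
        rw [h3, div_sub_div _ _ h1.ne' h2.ne', div_le_div_iff₀ (by positivity) (by positivity)]
        nlinarith
    _ = 1 / (N - 1) - 1 / ((k : ℝ) + N - 1) := by
        rw [Finset.sum_range_sub' fun j : ℕ => 1 / ((j : ℝ) + N - 1)]
        simp
    _ ≤ 1 / (N - 1) := sub_le_self _ (one_div_pos.mpr (hpos k)).le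

theorem mpolylog_summation (m : ℕ) (hm : 1 ≤ m) :
    ∑' j : ℕ, ((j : ℝ) + 2 * (2 * (m : ℝ) ^ 2 + 1)) *
        (2 : ℝ) ^ (-(Real.logb 2 ((j : ℝ) + 2 * (2 * (m : ℝ) ^ 2 + 1))) ^ 2)
      ≤ (2 : ℝ) ^ (-(Real.logb 2 (m : ℝ)) ^ 2) := by
  have hm1 : (1 : ℝ) ≤ m := by exact_mod_cast hm
  have hm0 : (0 : ℝ) < m := by linarith
  have hL : 0 ≤ Real.logb 2 (m : ℝ) := Real.logb_nonneg one_lt_two hm1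
  have hmL : (2 : ℝ) ^ Real.logb 2 (m : ℝ) = m :=
    Real.rpow_logb two_pos (by norm_num) hm0
  generalize Real.logb 2 (m : ℝ) = L at *
  have h4 : (2 : ℝ) ^ (2 + 2 * L) = 4 * (m : ℝ) ^ 2 := by
    rw [Real.rpow_add two_pos, mul_comm 2 L, Real.rpow_mul two_pos.le, hmL]
    norm_num
  have hN : 1 < 2 * (2 * (m : ℝ) ^ 2 + 1) := by nlinarith
  refine Real.tsum_le_of_sum_range_le (fun j => by positivity) fun k => ?_
  calc _ ≤ ∑ j ∈ Finset.range k, (2 : ℝ) ^ (3 * (2 + 2 * L) - (2 + 2 * L) ^ 2) *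
          (1 / ((j : ℝ) + 2 * (2 * (m : ℝ) ^ 2 + 1)) ^ 2) := by
        refine Finset.sum_le_sum fun j _ => ?_
        rw [mul_one_div]
        refine mul_two_rpow_neg_logb_sq_le (by positivity) (by linarith) ?_
        rw [Real.le_logb_iff_rpow_le one_lt_two (by positivity), h4]
        have := j.cast_nonneg (α := ℝ)
        linarith
    _ ≤ (2 : ℝ) ^ (3 * (2 + 2 * L) - (2 + 2 * L) ^ 2) * (1 / (2 : ℝ) ^ (2 + 2 * L)) := by
        rw [← Finset.mul_sum]
        refine mul_le_mul_of_nonneg_left ((sum_range_inv_add_sq_le hN k).trans ?_) (by positivity)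
        rw [h4]
        exact one_div_le_one_div_of_le (by positivity) (by linarith)
    _ ≤ (2 : ℝ) ^ (-L ^ 2) := by
        rw [mul_one_div, ← Real.rpow_sub two_pos]
        apply Real.rpow_le_rpow_of_exponent_le one_le_two
        nlinarith
end

section
/- Let μ be a Borel probability measure on Cantor space Σ^∞, let ⟨f_n⟩_{n≥1} be a sequence of Borel measurable functions f_n : Σ^∞ → ℝ, and let f : Σ^∞ → ℝ be Borel measurable. The following are equivalent: (i) there is a polynomial p such that for all m₁, m₂ ∈ ℕ, μ({x : ∃ n ≥ 2^{p(m₁+m₂)}, |f_n(x) − f(x)| ≥ 2^{−m₁}}) ≤ 2^{−m₂}; (ii) there is a polynomial p such that for all m₁, m₂ ≥ 2, μ({x : ∃ n ≥ 2^{p(⌈log₂ m₁⌉ + ⌈log₂ m₂⌉)}, |f_n(x) − f(x)| ≥ 2^{−(log₂ m₁)²}}) ≤ 2^{−(log₂ m₂)²}, where ⌈log₂ m⌉ is the ceiling of the base-2 logarithm and (log₂ m)² uses the real base-2 logarithm. -/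
open MeasureTheory

theorem Polynomial.monotone_eval_nat (p : Polynomial ℕ) : Monotone fun n : ℕ => p.eval n := by
  intro a b hab
  simp only [Polynomial.eval_eq_sum_range]
  gcongr

theorem setOf_exists_le_abs_mono {fseq : ℕ → Cantor → ℝ} {f : Cantor → ℝ} {N N' : ℕ} {ε ε' : ℝ}
    (hN : N' ≤ N) (hε : ε' ≤ ε) :
    {x | ∃ n : ℕ, N ≤ n ∧ ε ≤ |fseq n x - f x|} ⊆
      {x | ∃ n : ℕ, N' ≤ n ∧ ε' ≤ |fseq n x - f x|} := by
  rintro x ⟨n, hn, hx⟩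
  exact ⟨n, hN.trans hn, hε.trans hx⟩

theorem one_div_two_pow_eq_rpow (k : ℕ) : (1 : ℝ) / 2 ^ k = (2 : ℝ) ^ (-(k : ℝ)) := by
  rw [Real.rpow_neg zero_le_two, Real.rpow_natCast, one_div]

theorem one_div_two_pow_eq_ofReal (k : ℕ) :
    (1 : ENNReal) / 2 ^ k = ENNReal.ofReal ((1 : ℝ) / 2 ^ k) := by
  rw [ENNReal.ofReal_div_of_pos (by positivity), ENNReal.ofReal_pow zero_le_two]
  simp

theorem one_div_two_pow_clog_sq_le {m : ℕ} (hm : 2 ≤ m) :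
    (1 : ℝ) / 2 ^ (Nat.clog 2 m ^ 2) ≤ (2 : ℝ) ^ (-(Real.logb 2 (m : ℝ)) ^ 2) := by
  have hm' : (1 : ℝ) ≤ m := by exact_mod_cast (by lia : 1 ≤ m)
  have h0 : 0 ≤ Real.logb 2 (m : ℝ) := Real.logb_nonneg one_lt_two hm'
  have h1 : Real.logb 2 (m : ℝ) ≤ Nat.clog 2 m := by
    rw [Real.logb_le_iff_le_rpow one_lt_two (by linarith), Real.rpow_natCast]
    exact_mod_cast Nat.le_pow_clog one_lt_two m
  rw [one_div_two_pow_eq_rpow]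
  apply Real.rpow_le_rpow_of_exponent_le one_le_two
  push_cast
  gcongr

theorem two_rpow_neg_logb_two_pow_sq_le (k : ℕ) :
    (2 : ℝ) ^ (-(Real.logb 2 ((2 ^ (k + 1) : ℕ) : ℝ)) ^ 2) ≤ 1 / 2 ^ k := by
  have h : Real.logb 2 ((2 ^ (k + 1) : ℕ) : ℝ) = k + 1 := by
    push_cast
    rw [Real.logb_pow, Real.logb_self_eq_one one_lt_two]
    push_cast
    ring
  rw [h, one_div_two_pow_eq_rpow]
  apply Real.rpow_le_rpow_of_exponent_le one_le_two
  nlinarith [(Nat.cast_nonneg k : (0 : ℝ) ≤ k)]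

theorem pspace_rapid_ae_convergence_equivalence
    (μ : Measure Cantor) [IsProbabilityMeasure μ]
    (fseq : ℕ → Cantor → ℝ) (hmeas : ∀ n, Measurable (fseq n))
    (f : Cantor → ℝ) (hf : Measurable f) :
    (∃ p : Polynomial ℕ, ∀ m₁ m₂ : ℕ,
        μ {x | ∃ n : ℕ, 2 ^ p.eval (m₁ + m₂) ≤ n ∧
          (1 : ℝ) / 2 ^ m₁ ≤ |fseq n x - f x|} ≤ 1 / 2 ^ m₂) ↔
    (∃ p : Polynomial ℕ, ∀ m₁ m₂ : ℕ, 2 ≤ m₁ → 2 ≤ m₂ →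
        μ {x | ∃ n : ℕ, 2 ^ p.eval (Nat.clog 2 m₁ + Nat.clog 2 m₂) ≤ n ∧
          (2 : ℝ) ^ (-(Real.logb 2 (m₁ : ℝ)) ^ 2) ≤ |fseq n x - f x|}
          ≤ ENNReal.ofReal ((2 : ℝ) ^ (-(Real.logb 2 (m₂ : ℝ)) ^ 2))) := by
  constructor
  · rintro ⟨p, hp⟩
    refine ⟨p.comp (Polynomial.X ^ 2), fun m₁ m₂ h₁ h₂ => ?_⟩
    refine ((measure_mono (setOf_exists_le_abs_mono ?_ (one_div_two_pow_clog_sq_le h₁))).trans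
      (hp (Nat.clog 2 m₁ ^ 2) (Nat.clog 2 m₂ ^ 2))).trans ?_
    · simp only [Polynomial.eval_comp, Polynomial.eval_pow, Polynomial.eval_X]
      exact Nat.pow_le_pow_right two_pos (p.monotone_eval_nat (pow_add_pow_le (Nat.zero_le _) (Nat.zero_le _) two_ne_zero))
    · rw [one_div_two_pow_eq_ofReal]
      exact ENNReal.ofReal_le_ofReal (one_div_two_pow_clog_sq_le h₂)
  · rintro ⟨p, hp⟩
    refine ⟨p.comp (Polynomial.X + 2), fun m₁ m₂ => ?_⟩
    have two_le (k : ℕ) : 2 ≤ 2 ^ (k + 1) := Nat.le_self_pow k.succ_ne_zero 2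
    refine ((measure_mono (setOf_exists_le_abs_mono ?_ (two_rpow_neg_logb_two_pow_sq_le m₁))).trans
      (hp (2 ^ (m₁ + 1)) (2 ^ (m₂ + 1)) (two_le m₁) (two_le m₂))).trans ?_
    · rw [Nat.clog_pow 2 _ one_lt_two, Nat.clog_pow 2 _ one_lt_two, Polynomial.eval_comp]
      apply le_of_eq
      congr 2
      simp
      ring
    · rw [one_div_two_pow_eq_ofReal]
      exact ENNReal.ofReal_le_ofReal (two_rpow_neg_logb_two_pow_sq_le m₂)
end

section
/- Let μ be a Borel probability measure on Cantor space Σ^∞, let ⟨f_n⟩_{n≥1} be Borel measurable functions and f ∈ L¹(μ) with ‖f_n − f‖_{L¹(μ)} ≤ 2^{−(log₂ n)²} for all n ≥ 1 (real base-2 logarithm). Then for all natural numbers m₁, m₂ ≥ 1, μ({x : ∃ n ≥ 2(2(m₁m₂)² + 1), |f_n(x) − f(x)| ≥ 2^{−(log₂ m₁)²}}) ≤ 2^{−(log₂ m₂)²}. -/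
open MeasureTheory

/-- Markov's inequality for the `L¹` seminorm of a real function. -/
theorem measure_le_abs_le_of_eLpNorm_one_le {α : Type*} [MeasurableSpace α] {μ : Measure α}
    {g : α → ℝ} (hg : AEStronglyMeasurable g μ) {c e : ℝ} (hc : 0 < c)
    (h : eLpNorm g 1 μ ≤ ENNReal.ofReal e) :
    μ {x | c ≤ |g x|} ≤ ENNReal.ofReal (e / c) := by
  have hset : {x | c ≤ |g x|} = {x | ENNReal.ofReal c ≤ ‖g x‖ₑ} := by
    ext x
    simp only [Set.mem_ofPred_eq, ← ofReal_norm, Real.norm_eq_abs,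
      ENNReal.ofReal_le_ofReal_iff (abs_nonneg _)]
  rw [hset, ENNReal.ofReal_div_of_pos hc,
    ENNReal.le_div_iff_mul_le (Or.inl (by simpa using hc)) (Or.inl ENNReal.ofReal_ne_top),
    mul_comm]
  rw [eLpNorm_one_eq_lintegral_enorm] at h
  exact (mul_meas_ge_le_lintegral₀ hg.enorm _).trans h

theorem sum_range_inv_add_two_sq_le (K : ℕ) :
    ∑ k ∈ Finset.range K, (1 : ℝ) / ((k : ℝ) + 2) ^ 2 ≤ 1 - 1 / ((K : ℝ) + 1) := by
  induction K with
  | zero => simp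
  | succ K ih =>
    rw [Finset.sum_range_succ]
    have key : (1 : ℝ) / ((K : ℝ) + 2) ^ 2 ≤ 1 / ((K : ℝ) + 1) - 1 / ((K : ℝ) + 2) := by
      rw [div_sub_div _ _ (by positivity) (by positivity),
        div_le_div_iff₀ (by positivity) (by positivity)]
      nlinarith [(Nat.cast_nonneg K : (0 : ℝ) ≤ K)]
    have hK : ((K + 1 : ℕ) : ℝ) + 1 = (K : ℝ) + 2 := by push_cast; ring
    rw [hK]
    linarith

theorem subexp_div_subexp_le {m₁ m₂ n : ℕ} (h₁ : 1 ≤ m₁) (h₂ : 1 ≤ m₂)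
    (hn : 2 * (2 * (m₁ * m₂) ^ 2 + 1) ≤ n) :
    (2 : ℝ) ^ (-(Real.logb 2 (n : ℝ)) ^ 2) / (2 : ℝ) ^ (-(Real.logb 2 (m₁ : ℝ)) ^ 2)
      ≤ (2 : ℝ) ^ (-(Real.logb 2 (m₂ : ℝ)) ^ 2) * (1 / (n : ℝ) ^ 2) := by
  have hm₁ : (1 : ℝ) ≤ m₁ := by exact_mod_cast h₁
  have hm₂ : (1 : ℝ) ≤ m₂ := by exact_mod_cast h₂
  have hn' : (4 : ℝ) * (m₁ * m₂) ^ 2 ≤ n := by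
    have : 4 * (m₁ * m₂) ^ 2 ≤ n := by omega
    exact_mod_cast this
  have hpos : (0 : ℝ) < 4 * (m₁ * m₂) ^ 2 := by positivity
  have hn0 : (0 : ℝ) < n := hpos.trans_le hn'
  have hlog : 2 + 2 * (Real.logb 2 m₁ + Real.logb 2 m₂) ≤ Real.logb 2 n := by
    refine le_trans (le_of_eq ?_) (Real.logb_le_logb_of_le one_lt_two hpos hn')
    rw [Real.logb_mul (by norm_num) (by positivity), Real.logb_pow,
      Real.logb_mul (by positivity) (by positivity),
      show (4 : ℝ) = 2 ^ (2 : ℕ) by norm_num, Real.logb_pow, Real.logb_self_eq_one one_lt_two]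
    push_cast
    ring
  have hsq : (1 : ℝ) / (n : ℝ) ^ 2 = (2 : ℝ) ^ (-(2 * Real.logb 2 n)) := by
    rw [Real.rpow_neg zero_le_two, mul_comm, Real.rpow_mul zero_le_two,
      Real.rpow_logb two_pos (by norm_num) hn0, Real.rpow_two, one_div]
  rw [hsq, ← Real.rpow_sub two_pos, ← Real.rpow_add two_pos]
  refine Real.rpow_le_rpow_of_exponent_le one_le_two ?_
  have ha := Real.logb_nonneg one_lt_two hm₁
  have hb := Real.logb_nonneg one_lt_two hm₂
  generalize Real.logb 2 (m₁ : ℝ) = a at *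
  generalize Real.logb 2 (m₂ : ℝ) = b at *
  generalize Real.logb 2 (n : ℝ) = l at *
  have hl : (2 + 2 * (a + b)) * (2 * (a + b)) ≤ l * (l - 2) :=
    mul_le_mul hlog (by linarith) (by positivity) (by linarith)
  nlinarith [mul_nonneg ha hb, sq_nonneg a, sq_nonneg b]

theorem subexp_l1_approximation_ae
    (μ : Measure Cantor) [IsProbabilityMeasure μ]
    (fseq : ℕ → Cantor → ℝ) (hmeas : ∀ n, Measurable (fseq n))
    (f : Cantor → ℝ) (hf : Integrable f μ)
    (happrox : ∀ n : ℕ, 1 ≤ n →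
      eLpNorm (fun x => fseq n x - f x) 1 μ
        ≤ ENNReal.ofReal ((2 : ℝ) ^ (-(Real.logb 2 (n : ℝ)) ^ 2))) :
    ∀ m₁ m₂ : ℕ, 1 ≤ m₁ → 1 ≤ m₂ →
      μ {x | ∃ n : ℕ, 2 * (2 * (m₁ * m₂) ^ 2 + 1) ≤ n ∧
          (2 : ℝ) ^ (-(Real.logb 2 (m₁ : ℝ)) ^ 2) ≤ |fseq n x - f x|}
        ≤ ENNReal.ofReal ((2 : ℝ) ^ (-(Real.logb 2 (m₂ : ℝ)) ^ 2)) := by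
  intro m₁ m₂ h₁ h₂
  set N := 2 * (2 * (m₁ * m₂) ^ 2 + 1) with hN
  set c := (2 : ℝ) ^ (-(Real.logb 2 (m₁ : ℝ)) ^ 2) with hc
  set δ := (2 : ℝ) ^ (-(Real.logb 2 (m₂ : ℝ)) ^ 2) with hδ
  have hc0 : 0 < c := Real.rpow_pos_of_pos two_pos _
  have hδ0 : 0 ≤ δ := Real.rpow_nonneg zero_le_two _
  have hbound (k : ℕ) : μ {x | c ≤ |fseq (N + k) x - f x|}
      ≤ ENNReal.ofReal (δ * (1 / ((k : ℝ) + 2) ^ 2)) := by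
    refine (measure_le_abs_le_of_eLpNorm_one_le
      ((hmeas _).aestronglyMeasurable.sub hf.aestronglyMeasurable) hc0
      (happrox (N + k) (by omega))).trans (ENNReal.ofReal_le_ofReal ?_)
    refine (subexp_div_subexp_le h₁ h₂ (Nat.le_add_right N k)).trans ?_
    have hle : (k : ℝ) + 2 ≤ ((N + k : ℕ) : ℝ) := by
      have : k + 2 ≤ N + k := by omega
      exact_mod_cast this
    gcongr
  calc μ {x | ∃ n : ℕ, N ≤ n ∧ c ≤ |fseq n x - f x|}
      ≤ μ (⋃ k, {x | c ≤ |fseq (N + k) x - f x|}) := by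
        refine measure_mono fun x ⟨n, hn, hx⟩ => Set.mem_iUnion.2 ⟨n - N, ?_⟩
        simpa only [Set.mem_ofPred_eq, Nat.add_sub_cancel' hn] using hx
    _ ≤ ∑' k, μ {x | c ≤ |fseq (N + k) x - f x|} := measure_iUnion_le _
    _ ≤ ∑' k : ℕ, ENNReal.ofReal (δ * (1 / ((k : ℝ) + 2) ^ 2)) := ENNReal.tsum_le_tsum hbound
    _ ≤ ENNReal.ofReal δ := by
        refine ENNReal.tsum_le_of_sum_range_le fun K => ?_
        rw [← ENNReal.ofReal_sum_of_nonneg fun k _ => by positivity, ← Finset.mul_sum]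
        refine ENNReal.ofReal_le_ofReal (mul_le_of_le_one_right hδ0 ?_)
        exact (sum_range_inv_add_two_sq_le K).trans (sub_le_self _ (by positivity))
end
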